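/- arXiv:math/0405166 — 2 statements merged into one kernel-verified Lean document; each statement's English description precedes it below -/
import Mathlib

section
/- Let O ⊆ ℝ^N be open and let V : O → ℝ be lower semicontinuous and a viscosity supersolution of the constrained Hamilton–Jacobi–Bellman inequality on O. Let μ ∈ ℝ be such that the sublevel set K_μ := {x ∈ O : V(x) ≤ μ} is a closed subset of ℝ^N and its topological boundary ∂K_μ is contained in O. Then for every x ∈ ∂K_μ and every (p,Y) ∈ 𝒩²_{K_μ}(x) there exists α ∈ A such that σ(x,α)ᵀp = 0 and f(x,α)·p + trace[a(x,α)Y] ≥ 0 (the second-order Nagumo-type condition which, by the Bardi–Jensen viability theorem, characterizes viability of K_μ). -/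
open Matrix Filter Topology

/-- `(p, Y)` belongs to the second-order subjet `J^{2,-} V (x)` of `V : O → ℝ`:
`Y` is symmetric and `V y ≥ V x + p·(y-x) + ½ (y-x)·Y(y-x) + o(|y-x|²)` as `y → x` in `O`. -/
def InSubjet {d : ℕ} (O : Set (Fin d → ℝ)) (V : (Fin d → ℝ) → ℝ)
    (x p : Fin d → ℝ) (Y : Matrix (Fin d) (Fin d) ℝ) : Prop :=
  Y.IsSymm ∧ ∀ ε > (0 : ℝ), ∃ δ > (0 : ℝ), ∀ y ∈ O, ‖y - x‖ ≤ δ →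
    V y ≥ V x + p ⬝ᵥ (y - x) + (1 / 2) * ((y - x) ⬝ᵥ Y *ᵥ (y - x)) - ε * ‖y - x‖ ^ 2

/-- `(p, Y)` belongs to the second-order normal cone `𝒩²_K(x)`:
`Y` is symmetric and `p·(y-x) + ½ (y-x)·Y(y-x) ≥ o(|y-x|²)` as `y → x`, `y ∈ K`. -/
def InNormalCone {d : ℕ} (K : Set (Fin d → ℝ))
    (x p : Fin d → ℝ) (Y : Matrix (Fin d) (Fin d) ℝ) : Prop :=
  Y.IsSymm ∧ ∀ ε > (0 : ℝ), ∃ δ > (0 : ℝ), ∀ y ∈ K, ‖y - x‖ ≤ δ →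
    p ⬝ᵥ (y - x) + (1 / 2) * ((y - x) ⬝ᵥ Y *ᵥ (y - x)) ≥ -ε * ‖y - x‖ ^ 2

/-- `V` is a viscosity supersolution on `O` of the constrained Hamilton–Jacobi–Bellman
inequality `sup_{α ∈ A, σ(x,α)ᵀ DV = 0} { -DV·f(x,α) - trace[a(x,α) D²V] } ≥ 0`,
where `a := (1/2) σ σᵀ`. -/
def IsSupersolution {N M : ℕ} {A : Type*}
    (f : (Fin N → ℝ) → A → (Fin N → ℝ))
    (σ : (Fin N → ℝ) → A → Matrix (Fin N) (Fin M) ℝ)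
    (O : Set (Fin N → ℝ)) (V : (Fin N → ℝ) → ℝ) : Prop :=
  ∀ x ∈ O, ∀ p Y, InSubjet O V x p Y → ∃ α : A,
    (σ x α)ᵀ *ᵥ p = 0 ∧
    0 ≤ -(p ⬝ᵥ f x α) - trace ((((1 : ℝ) / 2) • (σ x α * (σ x α)ᵀ)) * Y)

lemma aux_log {u w a b r : ℝ} (ha : 0 ≤ a) (hb : 0 ≤ b) (hr : 0 ≤ r) (hr1 : r ≤ 1)
    (hu : |u| ≤ a * r) (hw : |w| ≤ b * r ^ 2) (hs : (a + b) * r ≤ 1 / 2) :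
    Real.log (1 - (u + w)) ≥ -u - w - u ^ 2 / 2 - (a * b + b ^ 2 / 2 + 2 * (a + b) ^ 3) * r ^ 3 := by
  have hr2 : r ^ 2 ≤ r := by nlinarith
  have hr4 : r ^ 4 ≤ r ^ 3 := pow_le_pow_of_le_one hr hr1 (by norm_num)
  have ht : |u + w| ≤ (a + b) * r := by
    have h1 := abs_add_le u w
    have h2 : b * r ^ 2 ≤ b * r := mul_le_mul_of_nonneg_left hr2 hb
    linarith
  have ht2 : |u + w| ≤ 1 / 2 := ht.trans hs
  have h := Real.abs_log_sub_add_sum_range_le (x := u + w) (by linarith) 2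
  have h3 : |u + w| ^ (2 + 1) / (1 - |u + w|) ≤ 2 * ((a + b) * r) ^ 3 := by
    rw [div_le_iff₀ (by linarith)]
    have h4 : |u + w| ^ 3 ≤ ((a + b) * r) ^ 3 := pow_le_pow_left₀ (abs_nonneg _) ht 3
    have h5 : 0 ≤ |u + w| ^ 3 := by positivity
    have h6 : 0 ≤ ((a + b) * r) ^ 3 := by positivity
    norm_num
    nlinarith
  have h7 := (abs_le.1 (h.trans h3)).1
  simp [Finset.sum_range_succ] at h7
  norm_num at h7
  have h8 : u * w ≤ a * b * r ^ 3 := by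
    calc u * w ≤ |u * w| := le_abs_self _
      _ = |u| * |w| := abs_mul _ _
      _ ≤ (a * r) * (b * r ^ 2) := mul_le_mul hu hw (abs_nonneg _) (by positivity)
      _ = _ := by ring
  have h9 : w ^ 2 ≤ b ^ 2 * r ^ 3 := by
    calc w ^ 2 = |w| ^ 2 := (sq_abs w).symm
      _ ≤ (b * r ^ 2) ^ 2 := pow_le_pow_left₀ (abs_nonneg _) hw 2
      _ = b ^ 2 * r ^ 4 := by ring
      _ ≤ _ := mul_le_mul_of_nonneg_left hr4 (by positivity)
  nlinarith

lemma aux_dot {d : ℕ} (q h : Fin d → ℝ) : |q ⬝ᵥ h| ≤ (∑ i, |q i|) * ‖h‖ := by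
  unfold dotProduct
  refine (Finset.abs_sum_le_sum_abs _ _).trans ?_
  rw [Finset.sum_mul]
  refine Finset.sum_le_sum fun i _ => ?_
  rw [abs_mul]
  exact mul_le_mul_of_nonneg_left (norm_le_pi_norm h i) (abs_nonneg _)

lemma aux_quad {d : ℕ} (Z : Matrix (Fin d) (Fin d) ℝ) :
    ∃ C : ℝ, 0 ≤ C ∧ ∀ h : Fin d → ℝ, |h ⬝ᵥ Z *ᵥ h| ≤ C * ‖h‖ ^ 2 := by
  refine ⟨∑ i, ∑ j, |Z i j|, by positivity, fun h => ?_⟩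
  rw [dotProduct]
  refine (Finset.abs_sum_le_sum_abs _ _).trans ?_
  rw [Finset.sum_mul]
  refine Finset.sum_le_sum fun i _ => ?_
  rw [abs_mul]
  calc |h i| * |(Z *ᵥ h) i| ≤ ‖h‖ * ((∑ j, |Z i j|) * ‖h‖) :=
        mul_le_mul (norm_le_pi_norm h i) (aux_dot (Z i) h) (abs_nonneg _) (norm_nonneg _)
    _ = _ := by ring

lemma aux_norm_le_dot {d : ℕ} (h : Fin d → ℝ) : ‖h‖ ^ 2 ≤ h ⬝ᵥ h := by
  have h0 : 0 ≤ h ⬝ᵥ h := by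
    unfold dotProduct
    exact Finset.sum_nonneg fun i _ => mul_self_nonneg _
  have : ‖h‖ ≤ Real.sqrt (h ⬝ᵥ h) := by
    refine (pi_norm_le_iff_of_nonneg (Real.sqrt_nonneg _)).2 fun i => ?_
    refine Real.le_sqrt_of_sq_le ?_
    rw [Real.norm_eq_abs, sq_abs, sq]
    exact Finset.single_le_sum (f := fun i => h i * h i) (fun i _ => mul_self_nonneg _)
      (Finset.mem_univ i)
  calc ‖h‖ ^ 2 ≤ Real.sqrt (h ⬝ᵥ h) ^ 2 := pow_le_pow_left₀ (norm_nonneg _) this 2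
    _ = _ := Real.sq_sqrt h0

lemma aux_subjet {d : ℕ} (O : Set (Fin d → ℝ)) (V : (Fin d → ℝ) → ℝ)
    (y0 q : Fin d → ℝ) (Z : Matrix (Fin d) (Fin d) ℝ) (hZ : Z.IsSymm) (m δ0 : ℝ) (hm : 0 < m)
    (hδ0 : 0 < δ0)
    (H : ∀ y ∈ O, ‖y - y0‖ ≤ δ0 →
      1 - (q ⬝ᵥ (y - y0) + (1 / 2) * ((y - y0) ⬝ᵥ Z *ᵥ (y - y0))) ≤ Real.exp (m * (V y - V y0))) :
    InSubjet O V y0 (-((1 / m) • q)) (-((1 / m) • (Z + vecMulVec q q))) := by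
  refine ⟨?_, ?_⟩
  · have h1 : (vecMulVec q q).IsSymm := by
      ext i j; simp [vecMulVec_apply, mul_comm]
    exact ((hZ.add h1).smul _).neg
  intro ε hε
  obtain ⟨C, hC, hCb⟩ := aux_quad Z
  set a := ∑ i, |q i| with ha
  have ha0 : 0 ≤ a := by positivity
  set D := a * C + C ^ 2 / 2 + 2 * (a + C) ^ 3 with hD
  have hD0 : 0 ≤ D := by positivity
  refine ⟨min (min δ0 1) (min (1 / (2 * (a + C + 1))) (m * ε / (D + 1))), by positivity, ?_⟩
  intro y hy hyn
  simp only [le_min_iff] at hyn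
  obtain ⟨⟨hn1, hn2⟩, hn3, hn4⟩ := hyn
  have hH := H y hy hn1
  set h := y - y0 with hh
  have hu := aux_dot q h
  have hw : |(1 / 2) * (h ⬝ᵥ Z *ᵥ h)| ≤ C * ‖h‖ ^ 2 := by
    rw [abs_mul]; norm_num
    have := hCb h
    have := abs_nonneg (h ⬝ᵥ Z *ᵥ h)
    linarith
  have hr := norm_nonneg h
  have hs : (a + C) * ‖h‖ ≤ 1 / 2 := by
    rw [le_div_iff₀ (by positivity)] at hn3
    nlinarith
  have hl := aux_log ha0 hC hr hn2 hu hw hs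
  rw [← hD] at hl
  have hpos : 0 < 1 - (q ⬝ᵥ h + (1 / 2) * (h ⬝ᵥ Z *ᵥ h)) := by
    have h1 := (abs_le.1 hu).2
    have h2 := (abs_le.1 hw).2
    have : C * ‖h‖ ^ 2 ≤ C * ‖h‖ := mul_le_mul_of_nonneg_left (by nlinarith) hC
    linarith
  have hl2 := (Real.log_le_log hpos hH)
  rw [Real.log_exp] at hl2
  have hq : h ⬝ᵥ (vecMulVec q q) *ᵥ h = (q ⬝ᵥ h) ^ 2 := by
    rw [vecMulVec_mulVec]
    simp [dotProduct_comm h q, sq]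
  have hDb : D * ‖h‖ ^ 3 ≤ m * ε * ‖h‖ ^ 2 := by
    rw [le_div_iff₀ (by positivity)] at hn4
    have : D * ‖h‖ ≤ m * ε := by nlinarith
    calc D * ‖h‖ ^ 3 = D * ‖h‖ * ‖h‖ ^ 2 := by ring
      _ ≤ _ := mul_le_mul_of_nonneg_right this (by positivity)
  have key : m * (V y - V y0) ≥ - (q ⬝ᵥ h) - (1 / 2) * (h ⬝ᵥ Z *ᵥ h) - (q ⬝ᵥ h) ^ 2 / 2
      - m * ε * ‖h‖ ^ 2 := by linarith
  simp only [neg_dotProduct, smul_dotProduct, neg_mulVec, smul_mulVec, dotProduct_neg,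
    dotProduct_smul, add_mulVec, dotProduct_add, hq, smul_eq_mul]
  have : V y - V y0 ≥ (- (q ⬝ᵥ h) - (1 / 2) * (h ⬝ᵥ Z *ᵥ h) - (q ⬝ᵥ h) ^ 2 / 2
      - m * ε * ‖h‖ ^ 2) / m := by
    rw [ge_iff_le, div_le_iff₀ hm]; linarith
  have e : (- (q ⬝ᵥ h) - (1 / 2) * (h ⬝ᵥ Z *ᵥ h) - (q ⬝ᵥ h) ^ 2 / 2
      - m * ε * ‖h‖ ^ 2) / m = -(1 / m * (q ⬝ᵥ h)) + 1 / 2 * (-(1 / m * (h ⬝ᵥ Z *ᵥ h + (q ⬝ᵥ h) ^ 2)))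
        - ε * ‖h‖ ^ 2 := by
    field_simp; ring
  linarith

lemma aux_expand {d : ℕ} (p x y z : Fin d → ℝ) (Z : Matrix (Fin d) (Fin d) ℝ) (hZ : Z.IsSymm) :
    p ⬝ᵥ (y - x) + (1 / 2) * ((y - x) ⬝ᵥ Z *ᵥ (y - x)) =
      (p ⬝ᵥ (z - x) + (1 / 2) * ((z - x) ⬝ᵥ Z *ᵥ (z - x))) +
      ((p + Z *ᵥ (z - x)) ⬝ᵥ (y - z) + (1 / 2) * ((y - z) ⬝ᵥ Z *ᵥ (y - z))) := by
  have e : y - x = (z - x) + (y - z) := by abel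
  rw [e]
  generalize z - x = a
  generalize y - z = b
  have h1 : a ⬝ᵥ Z *ᵥ b = (Z *ᵥ a) ⬝ᵥ b := by
    rw [dotProduct_mulVec, ← mulVec_transpose, hZ.eq]
  simp only [dotProduct_add, add_dotProduct, mulVec_add, h1]
  rw [dotProduct_comm b (Z *ᵥ a)]
  ring

/-- one-step: from the supersolution property with the quadratic test function -/
lemma aux_super {N M : ℕ} {A : Type*}
    (f : (Fin N → ℝ) → A → (Fin N → ℝ))
    (σ : (Fin N → ℝ) → A → Matrix (Fin N) (Fin M) ℝ)
    (O : Set (Fin N → ℝ)) (V : (Fin N → ℝ) → ℝ) (hsuper : IsSupersolution f σ O V)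
    (y0 q : Fin N → ℝ) (hy0 : y0 ∈ O) (Z : Matrix (Fin N) (Fin N) ℝ) (hZ : Z.IsSymm)
    (m δ0 c0 μ : ℝ) (hm : 0 < m) (hc0 : 0 < c0)
    (hδ0 : 0 < δ0)
    (H : ∀ y ∈ O, ‖y - y0‖ ≤ δ0 →
      c0 * Real.exp (m * (V y0 - μ)) ≤ c0 * Real.exp (m * (V y - μ)) +
        (q ⬝ᵥ (y - y0) + (1 / 2) * ((y - y0) ⬝ᵥ Z *ᵥ (y - y0)))) :
    ∃ α : A, (σ y0 α)ᵀ *ᵥ q = 0 ∧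
      0 ≤ f y0 α ⬝ᵥ q + trace ((((1 : ℝ) / 2) • (σ y0 α * (σ y0 α)ᵀ)) * Z) := by
  set c := c0 * Real.exp (m * (V y0 - μ)) with hc
  have hcp : 0 < c := by positivity
  have hJ := aux_subjet O V y0 ((1 / c) • q) ((1 / c) • Z) (hZ.smul _) m δ0 hm hδ0 (by
    intro y hy hyn
    have h1 := H y hy hyn
    have e : c0 * Real.exp (m * (V y - μ)) = c * Real.exp (m * (V y - V y0)) := by
      rw [hc, mul_assoc, ← Real.exp_add]; ring_nf
    rw [e] at h1
    simp only [smul_dotProduct, smul_mulVec, dotProduct_smul, smul_eq_mul]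
    set g1 := q ⬝ᵥ (y - y0)
    set g2 := (y - y0) ⬝ᵥ Z *ᵥ (y - y0)
    have e2 : 1 - (1 / c * g1 + 1 / 2 * (1 / c * g2)) = (c - (g1 + 1 / 2 * g2)) / c := by
      field_simp
    rw [e2, div_le_iff₀ hcp]
    linarith)
  obtain ⟨α, h1, h2⟩ := hsuper y0 hy0 _ _ hJ
  have hq : (σ y0 α)ᵀ *ᵥ q = 0 := by
    rw [mulVec_neg, mulVec_smul, mulVec_smul, neg_eq_zero, smul_smul] at h1
    exact (smul_eq_zero.1 h1).resolve_left (by positivity)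
  refine ⟨α, hq, ?_⟩
  have hvv : (σ y0 α * (σ y0 α)ᵀ) * vecMulVec ((1 / c) • q) ((1 / c) • q) = 0 := by
    rw [Matrix.mul_assoc, mul_vecMulVec, mulVec_smul, hq]
    simp
  have h3 : trace ((((1 : ℝ) / 2) • (σ y0 α * (σ y0 α)ᵀ)) *
      (-((1 / m) • ((1 / c) • Z + vecMulVec ((1 / c) • q) ((1 / c) • q))))) =
      -((1 / (m * c)) * trace ((((1 : ℝ) / 2) • (σ y0 α * (σ y0 α)ᵀ)) * Z)) := by
    rw [Matrix.mul_neg, Matrix.mul_smul, Matrix.mul_add, Matrix.smul_mul _ _ (vecMulVec _ _), hvv,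
      Matrix.mul_smul, smul_zero, add_zero, trace_neg, trace_smul, trace_smul]
    simp only [smul_eq_mul]; field_simp
  rw [h3] at h2
  simp only [neg_dotProduct, smul_dotProduct, smul_eq_mul] at h2
  rw [dotProduct_comm (f y0 α) q]
  set T := trace ((((1 : ℝ) / 2) • (σ y0 α * (σ y0 α)ᵀ)) * Z)
  set F := q ⬝ᵥ f y0 α
  have e : - -(1 / m * (1 / c * F)) - -(1 / (m * c) * T) = (F + T) / (m * c) := by
    field_simp; ring
  rw [e] at h2
  have := mul_nonneg h2 (le_of_lt (mul_pos hm hcp))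
  rwa [div_mul_cancel₀ _ (by positivity)] at this

lemma aux_approx {N M : ℕ} {A : Type*}
    (f : (Fin N → ℝ) → A → (Fin N → ℝ))
    (σ : (Fin N → ℝ) → A → Matrix (Fin N) (Fin M) ℝ)
    (O : Set (Fin N → ℝ)) (hO : IsOpen O)
    (V : (Fin N → ℝ) → ℝ)
    (hV : LowerSemicontinuousOn V O)
    (hsuper : IsSupersolution f σ O V)
    (μ : ℝ) (x : Fin N → ℝ) (hx : x ∈ O) (hxμ : V x ≤ μ)
    (p : Fin N → ℝ) (Y : Matrix (Fin N) (Fin N) ℝ)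
    (hN : InNormalCone {x | x ∈ O ∧ V x ≤ μ} x p Y) (ε : ℝ) (hε : 0 < ε) :
    ∃ (y : Fin N → ℝ) (α : A), ‖y - x‖ < ε ∧
      (σ y α)ᵀ *ᵥ (p + (Y + (4 * ε) • (1 : Matrix (Fin N) (Fin N) ℝ)) *ᵥ (y - x)) = 0 ∧
      0 ≤ f y α ⬝ᵥ (p + (Y + (4 * ε) • (1 : Matrix (Fin N) (Fin N) ℝ)) *ᵥ (y - x)) +
        trace ((((1 : ℝ) / 2) • (σ y α * (σ y α)ᵀ)) *
          (Y + (4 * ε) • (1 : Matrix (Fin N) (Fin N) ℝ))) := by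
  obtain ⟨hYs, hY⟩ := hN
  obtain ⟨δ, hδ, hδK⟩ := hY ε hε
  obtain ⟨r0, hr0, hr0O⟩ := Metric.nhds_basis_closedBall.mem_iff.1 (hO.mem_nhds hx)
  set r := min r0 δ with hr
  have hrp : 0 < r := lt_min hr0 hδ
  have hball : Metric.closedBall x r ⊆ O :=
    (Metric.closedBall_subset_closedBall (min_le_left _ _)).trans hr0O
  set Z := Y + (4 * ε) • (1 : Matrix (Fin N) (Fin N) ℝ) with hZ
  have hZs : Z.IsSymm := hYs.add (isSymm_one.smul _)
  set G : (Fin N → ℝ) → ℝ := fun y => p ⬝ᵥ (y - x) + (1 / 2) * ((y - x) ⬝ᵥ Z *ᵥ (y - x)) with hG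
  have hGc : Continuous G := by
    have h0 : Continuous fun y : Fin N → ℝ => y - x := by fun_prop
    exact (continuous_const.dotProduct h0).add (continuous_const.mul
      (h0.dotProduct (continuous_const.matrix_mulVec h0)))
  have hGx : G x = 0 := by simp [hG]
  have hGK : ∀ y ∈ Metric.closedBall x r, V y ≤ μ → ε * ‖y - x‖ ^ 2 ≤ G y := by
    intro y hy hyμ
    have h1 := hδK y ⟨hball hy, hyμ⟩ (by
      rw [← dist_eq_norm]; exact (Metric.mem_closedBall.1 hy).trans (min_le_right _ _))
    have h2 := aux_norm_le_dot (y - x)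
    have e : G y = p ⬝ᵥ (y - x) + (1 / 2) * ((y - x) ⬝ᵥ Y *ᵥ (y - x)) +
        2 * ε * ((y - x) ⬝ᵥ (y - x)) := by
      simp only [hG, hZ, add_mulVec, smul_mulVec, one_mulVec, dotProduct_add, dotProduct_smul,
        smul_eq_mul]
      ring
    rw [e]
    nlinarith
  have hmin : ∀ n : ℕ, ∃ y ∈ Metric.closedBall x r, ∀ z ∈ Metric.closedBall x r,
      (1 / ((n : ℝ) + 1)) * Real.exp (((n : ℝ) + 1) ^ 2 * (V y - μ)) + G y ≤
      (1 / ((n : ℝ) + 1)) * Real.exp (((n : ℝ) + 1) ^ 2 * (V z - μ)) + G z := by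
    intro n
    have hl : LowerSemicontinuousOn (fun y =>
        (1 / ((n : ℝ) + 1)) * Real.exp (((n : ℝ) + 1) ^ 2 * (V y - μ)) + G y)
        (Metric.closedBall x r) := by
      refine LowerSemicontinuousOn.add ?_ (hGc.lowerSemicontinuous.lowerSemicontinuousOn _)
      refine Continuous.comp_lowerSemicontinuousOn
        (g := fun s : ℝ => (1 / ((n : ℝ) + 1)) * Real.exp (((n : ℝ) + 1) ^ 2 * (s - μ)))
        (by fun_prop) (hV.mono hball) ?_
      intro s t hst
      dsimp only
      gcongr
    obtain ⟨y, hy, hym⟩ := hl.exists_isMinOn ⟨x, Metric.mem_closedBall_self hrp.le⟩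
      (isCompact_closedBall x r)
    exact ⟨y, hy, fun z hz => hym hz⟩
  choose Yn hYn hYmin using hmin
  have hle : ∀ n : ℕ, (1 / ((n : ℝ) + 1)) * Real.exp (((n : ℝ) + 1) ^ 2 * (V (Yn n) - μ)) +
      G (Yn n) ≤ 1 / ((n : ℝ) + 1) := by
    intro n
    refine (hYmin n x (Metric.mem_closedBall_self hrp.le)).trans ?_
    rw [hGx, add_zero]
    have : Real.exp (((n : ℝ) + 1) ^ 2 * (V x - μ)) ≤ 1 := by
      rw [Real.exp_le_one_iff]
      exact mul_nonpos_of_nonneg_of_nonpos (by positivity) (by linarith)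
    exact mul_le_of_le_one_right (by positivity) this
  obtain ⟨z, hz, φ, hφ, hlim⟩ := (isCompact_closedBall x r).tendsto_subseq hYn
  have hinv : Tendsto (fun k : ℕ => 1 / (((φ k : ℕ) : ℝ) + 1)) atTop (𝓝 0) :=
    tendsto_one_div_add_atTop_nhds_zero_nat.comp hφ.tendsto_atTop
  have hGlim : Tendsto (fun k => G (Yn (φ k))) atTop (𝓝 (G z)) :=
    (hGc.tendsto z).comp hlim
  have hGz : G z ≤ 0 := by
    refine le_of_tendsto_of_tendsto' hGlim hinv fun k => ?_
    have := hle (φ k)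
    have h0 : 0 ≤ (1 / (((φ k : ℕ) : ℝ) + 1)) *
      Real.exp ((((φ k : ℕ) : ℝ) + 1) ^ 2 * (V (Yn (φ k)) - μ)) := by positivity
    linarith
  have hVz : V z ≤ μ := by
    by_contra hcon
    push Not at hcon
    obtain ⟨μ', h1, h2⟩ := exists_between hcon
    have hev : ∀ᶠ k in atTop, μ' < V (Yn (φ k)) := by
      have := hV z (hball hz) μ' h2
      refine (tendsto_nhdsWithin_iff.2 ⟨hlim, ?_⟩).eventually this
      exact Eventually.of_forall fun k => hball (hYn _)
    have hbig : Tendsto (fun k : ℕ => (((φ k : ℕ) : ℝ) + 1) * (μ' - μ)) atTop atTop := by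
      refine Tendsto.atTop_mul_const (by linarith) ?_
      exact tendsto_atTop_add_const_right _ _
        (tendsto_natCast_atTop_atTop.comp hφ.tendsto_atTop)
    have hb := (hinv.sub hGlim).eventually (gt_mem_nhds (lt_add_one _))
    obtain ⟨k, hk1, hk2, hk3⟩ := (hev.and (hb.and (hbig.eventually_ge_atTop (0 - G z + 1)))).exists
    have h3 := hle (φ k)
    set n : ℝ := ((φ k : ℕ) : ℝ) + 1 with hn
    have hnp : 0 < n := by positivity
    have h4 : n * (μ' - μ) ≤ (1 / n) * Real.exp (n ^ 2 * (V (Yn (φ k)) - μ)) := by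
      have h5 := Real.add_one_le_exp (n ^ 2 * (V (Yn (φ k)) - μ))
      have h6 : n ^ 2 * (μ' - μ) ≤ n ^ 2 * (V (Yn (φ k)) - μ) := by gcongr
      rw [one_div_mul_eq_div, le_div_iff₀ hnp]
      nlinarith
    linarith
  have hzx : z = x := by
    have h1 := hGK z hz hVz
    have h2 : ‖z - x‖ ^ 2 ≤ 0 := by nlinarith
    have h3 : ‖z - x‖ = 0 := by nlinarith [norm_nonneg (z - x)]
    exact sub_eq_zero.1 (norm_eq_zero.1 h3)
  subst hzx
  obtain ⟨k, hk⟩ := (hlim.eventually (Metric.ball_mem_nhds z (lt_min hrp hε))).exists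
  have hk' : ‖Yn (φ k) - z‖ < min r ε := by
    rw [← dist_eq_norm]; exact hk
  set n : ℝ := ((φ k : ℕ) : ℝ) + 1 with hn
  have hnp : 0 < n := by positivity
  obtain ⟨α, h1, h2⟩ := aux_super f σ O V hsuper (Yn (φ k)) (p + Z *ᵥ (Yn (φ k) - z))
    (hball (hYn _)) Z hZs (n ^ 2) (r - ‖Yn (φ k) - z‖) (1 / n) μ (by positivity) (by positivity)
    (by have := lt_min_iff.1 hk'; linarith) (by
      intro y hy hyn
      have hyb : y ∈ Metric.closedBall z r := by
        rw [Metric.mem_closedBall, dist_eq_norm]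
        have : y - z = (y - Yn (φ k)) + (Yn (φ k) - z) := by abel
        rw [this]
        exact (norm_add_le _ _).trans (by linarith)
      have h := hYmin (φ k) y hyb
      have e : G y = G (Yn (φ k)) + _ := aux_expand p z y (Yn (φ k)) Z hZs
      rw [e] at h
      linarith)
  exact ⟨Yn (φ k), α, (lt_min_iff.1 hk').2, h1, h2⟩

lemma aux_cont1
    {N M : ℕ} {A : Type*} [MetricSpace A]
    (f : (Fin N → ℝ) → A → (Fin N → ℝ))
    (σ : (Fin N → ℝ) → A → Matrix (Fin N) (Fin M) ℝ)
    (hf : Continuous fun q : (Fin N → ℝ) × A => f q.1 q.2)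
    (hσ : Continuous fun q : (Fin N → ℝ) × A => σ q.1 q.2)
    (x p : Fin N → ℝ) (Y : Matrix (Fin N) (Fin N) ℝ) :
    Continuous fun w : ((Fin N → ℝ) × A) × ℝ => (σ w.1.1 w.1.2)ᵀ *ᵥ
      (p + (Y + (4 * w.2) • (1 : Matrix (Fin N) (Fin N) ℝ)) *ᵥ (w.1.1 - x)) := by
  have hσ' : Continuous fun w : ((Fin N → ℝ) × A) × ℝ => σ w.1.1 w.1.2 :=
    hσ.comp continuous_fst
  have hf' : Continuous fun w : ((Fin N → ℝ) × A) × ℝ => f w.1.1 w.1.2 :=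
    hf.comp continuous_fst
  have hZ' : Continuous fun w : ((Fin N → ℝ) × A) × ℝ =>
      Y + (4 * w.2) • (1 : Matrix (Fin N) (Fin N) ℝ) := by fun_prop
  have hq' : Continuous fun w : ((Fin N → ℝ) × A) × ℝ =>
      p + (Y + (4 * w.2) • (1 : Matrix (Fin N) (Fin N) ℝ)) *ᵥ (w.1.1 - x) :=
    continuous_const.add (hZ'.matrix_mulVec (by fun_prop))
  exact
      hσ'.matrix_transpose.matrix_mulVec hq'

lemma aux_cont2
    {N M : ℕ} {A : Type*} [MetricSpace A]
    (f : (Fin N → ℝ) → A → (Fin N → ℝ))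
    (σ : (Fin N → ℝ) → A → Matrix (Fin N) (Fin M) ℝ)
    (hf : Continuous fun q : (Fin N → ℝ) × A => f q.1 q.2)
    (hσ : Continuous fun q : (Fin N → ℝ) × A => σ q.1 q.2)
    (x p : Fin N → ℝ) (Y : Matrix (Fin N) (Fin N) ℝ) :
    Continuous fun w : ((Fin N → ℝ) × A) × ℝ => f w.1.1 w.1.2 ⬝ᵥ
      (p + (Y + (4 * w.2) • (1 : Matrix (Fin N) (Fin N) ℝ)) *ᵥ (w.1.1 - x)) +
        trace ((((1 : ℝ) / 2) • (σ w.1.1 w.1.2 * (σ w.1.1 w.1.2)ᵀ)) *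
          (Y + (4 * w.2) • (1 : Matrix (Fin N) (Fin N) ℝ))) := by
  have hσ' : Continuous fun w : ((Fin N → ℝ) × A) × ℝ => σ w.1.1 w.1.2 :=
    hσ.comp continuous_fst
  have hf' : Continuous fun w : ((Fin N → ℝ) × A) × ℝ => f w.1.1 w.1.2 :=
    hf.comp continuous_fst
  have hZ' : Continuous fun w : ((Fin N → ℝ) × A) × ℝ =>
      Y + (4 * w.2) • (1 : Matrix (Fin N) (Fin N) ℝ) := by fun_prop
  have hq' : Continuous fun w : ((Fin N → ℝ) × A) × ℝ =>
      p + (Y + (4 * w.2) • (1 : Matrix (Fin N) (Fin N) ℝ)) *ᵥ (w.1.1 - x) :=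
    continuous_const.add (hZ'.matrix_mulVec (by fun_prop))
  have t1 : Continuous fun w : ((Fin N → ℝ) × A) × ℝ => σ w.1.1 w.1.2 * (σ w.1.1 w.1.2)ᵀ :=
    hσ'.matrix_mul hσ'.matrix_transpose
  have t2 : Continuous fun w : ((Fin N → ℝ) × A) × ℝ =>
      ((1 : ℝ) / 2) • (σ w.1.1 w.1.2 * (σ w.1.1 w.1.2)ᵀ) := t1.const_smul ((1 : ℝ) / 2)
  have t3 := t2.matrix_mul hZ'
  have t4 := t3.matrix_trace
  exact (hf'.dotProduct hq').add t4

/-- If `V` is a lower semicontinuous viscosity supersolution of the constrained HJB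
inequality on an open set `O`, and the sublevel set `K_μ = {x ∈ O : V x ≤ μ}` is closed
with topological boundary contained in `O`, then `K_μ` satisfies the second-order
Nagumo-type condition of the Bardi–Jensen viability theorem. -/
theorem sublevel_sets_satisfy_nagumo_condition
    {N M : ℕ} (hN : 0 < N) (hM : 0 < M)
    {A : Type*} [MetricSpace A] [CompactSpace A]
    (f : (Fin N → ℝ) → A → (Fin N → ℝ))
    (σ : (Fin N → ℝ) → A → Matrix (Fin N) (Fin M) ℝ)
    (hf : Continuous fun q : (Fin N → ℝ) × A => f q.1 q.2)
    (hσ : Continuous fun q : (Fin N → ℝ) × A => σ q.1 q.2)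
    (O : Set (Fin N → ℝ)) (hO : IsOpen O)
    (V : (Fin N → ℝ) → ℝ)
    (hV : LowerSemicontinuousOn V O)
    (hsuper : IsSupersolution f σ O V)
    (μ : ℝ)
    (hclosed : IsClosed {x | x ∈ O ∧ V x ≤ μ})
    (hbd : frontier {x | x ∈ O ∧ V x ≤ μ} ⊆ O) :
    ∀ x ∈ frontier {x | x ∈ O ∧ V x ≤ μ},
      ∀ (p : Fin N → ℝ) (Y : Matrix (Fin N) (Fin N) ℝ),
        InNormalCone {x | x ∈ O ∧ V x ≤ μ} x p Y → ∃ α : A,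
          (σ x α)ᵀ *ᵥ p = 0 ∧
          0 ≤ f x α ⬝ᵥ p + trace ((((1 : ℝ) / 2) • (σ x α * (σ x α)ᵀ)) * Y) := by
  intro x hx p Y hpY
  have hxK := hclosed.frontier_subset hx
  have H := fun k : ℕ => aux_approx f σ O hO V hV hsuper μ x hxK.1 hxK.2 p Y hpY
    (1 / ((k : ℝ) + 1)) (by positivity)
  choose y α h1 h2 h3 using H
  obtain ⟨β, -, φ, hφ, hlim⟩ := isCompact_univ.tendsto_subseq (fun n => Set.mem_univ (α n))
  have hinv0 : Tendsto (fun k : ℕ => 1 / ((k : ℝ) + 1)) atTop (𝓝 0) :=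
    tendsto_one_div_add_atTop_nhds_zero_nat
  have hinv := hinv0.comp hφ.tendsto_atTop
  have hy0 : Tendsto y atTop (𝓝 x) := by
    rw [tendsto_iff_norm_sub_tendsto_zero]
    exact squeeze_zero (fun _ => norm_nonneg _) (fun k => (h1 k).le) hinv0
  have hy := hy0.comp hφ.tendsto_atTop
  have ht : Tendsto (fun k => ((y (φ k), α (φ k)), 1 / (((φ k : ℕ) : ℝ) + 1))) atTop
      (𝓝 ((x, β), (0 : ℝ))) := (hy.prodMk_nhds hlim).prodMk_nhds hinv
  have hc1 := aux_cont1 f σ hf hσ x p Y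
  have hc2 := aux_cont2 f σ hf hσ x p Y
  have l1 := (hc1.tendsto _).comp ht
  have l2 := (hc2.tendsto _).comp ht
  refine ⟨β, ?_, ?_⟩
  · have l3 := tendsto_nhds_unique l1
      (tendsto_const_nhds.congr fun k => (h2 (φ k)).symm)
    simpa using l3
  · have l4 := ge_of_tendsto' l2 (fun k => h3 (φ k))
    simpa using l4
end

section
/- Let O ⊆ ℝ^N be open and let u_n : O → ℝ be a nondecreasing sequence (u_n ≤ u_{n+1} pointwise) of lower semicontinuous functions whose pointwise limit u(x) := sup_n u_n(x) is finite for every x ∈ O. Fix x ∈ O and (p,Y) ∈ J^{2,−}u(x). Then there exist, for all sufficiently large n, points x_n ∈ O and pairs (p_n, Y_n) ∈ J^{2,−}u_n(x_n) such that x_n → x, u_n(x_n) → u(x), p_n → p and Y_n → Y as n → ∞. -/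
open Matrix Filter Topology

lemma quad_expand {d : ℕ} (p a b : Fin d → ℝ) (Y : Matrix (Fin d) (Fin d) ℝ) (hY : Y.IsSymm)
    (e : ℝ) :
    p ⬝ᵥ (a + b) + (1 / 2) * ((a + b) ⬝ᵥ Y *ᵥ (a + b)) - e * ((a + b) ⬝ᵥ (a + b)) =
    (p ⬝ᵥ a + (1 / 2) * (a ⬝ᵥ Y *ᵥ a) - e * (a ⬝ᵥ a)) +
      (p + Y *ᵥ a - (2 * e) • a) ⬝ᵥ b
      + (1 / 2) * (b ⬝ᵥ (Y - (2 * e) • (1 : Matrix (Fin d) (Fin d) ℝ)) *ᵥ b) := by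
  have h1 : a ⬝ᵥ Y *ᵥ b = (Y *ᵥ a) ⬝ᵥ b := by
    rw [dotProduct_mulVec, ← mulVec_transpose, hY.eq]
  have h2 : b ⬝ᵥ Y *ᵥ a = (Y *ᵥ a) ⬝ᵥ b := dotProduct_comm _ _
  have h3 : b ⬝ᵥ a = a ⬝ᵥ b := dotProduct_comm _ _
  simp only [mulVec_add, dotProduct_add, add_dotProduct, sub_dotProduct, sub_mulVec,
    smul_mulVec, one_mulVec, dotProduct_sub, smul_dotProduct, dotProduct_smul, smul_eq_mul,
    h1, h2, h3]
  ring

lemma norm_sq_le_dot {d : ℕ} (w : Fin d → ℝ) : ‖w‖ ^ 2 ≤ w ⬝ᵥ w := by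
  have h0 : 0 ≤ w ⬝ᵥ w := Finset.sum_nonneg fun i _ => mul_self_nonneg _
  have : ‖w‖ ≤ √(w ⬝ᵥ w) := by
    refine (pi_norm_le_iff_of_nonneg (Real.sqrt_nonneg _)).2 fun i => ?_
    rw [Real.norm_eq_abs]
    refine Real.abs_le_sqrt ?_
    rw [sq]
    exact Finset.single_le_sum (f := fun i => w i * w i)
      (fun i _ => mul_self_nonneg _) (Finset.mem_univ i)
  calc ‖w‖ ^ 2 ≤ √(w ⬝ᵥ w) ^ 2 := by gcongr
    _ = _ := Real.sq_sqrt h0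

lemma dini_lower {d : ℕ} {B : Set (Fin d → ℝ)} (hB : IsCompact B)
    (f : ℕ → (Fin d → ℝ) → ℝ) (hf : ∀ n, LowerSemicontinuousOn (f n) B)
    (hm : ∀ y ∈ B, Monotone fun n => f n y) (a : ℝ) (ha : ∀ y ∈ B, ∃ n, a < f n y) :
    ∃ n₀, ∀ n ≥ n₀, ∀ y ∈ B, a < f n y := by
  have key : ∃ n₀, ∀ n ≥ n₀, ∀ y ∈ B, y ∈ B → a < f n y := by
    refine hB.induction_on (p := fun s => ∃ n₀, ∀ n ≥ n₀, ∀ y ∈ s, y ∈ B → a < f n y) ?_ ?_ ?_ ?_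
    · exact ⟨0, by simp⟩
    · rintro s t hst ⟨n, hn⟩
      exact ⟨n, fun m hm' y hy => hn m hm' y (hst hy)⟩
    · rintro s t ⟨n, hn⟩ ⟨m, hm'⟩
      refine ⟨max n m, fun k hk y hy hyB => ?_⟩
      rcases hy with hy | hy
      · exact hn k (le_trans (le_max_left _ _) hk) y hy hyB
      · exact hm' k (le_trans (le_max_right _ _) hk) y hy hyB
    · intro y hy
      obtain ⟨n, hn⟩ := ha y hy
      refine ⟨_, hf n y hy a hn, n, fun m hmn z hz hzB => lt_of_lt_of_le hz (hm z hzB hmn)⟩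
  obtain ⟨n, hn⟩ := key
  exact ⟨n, fun m hm y hy => hn m hm y hy hy⟩

lemma subjet_step
    {N : ℕ} (O : Set (Fin N → ℝ)) (hO : IsOpen O)
    (useq : ℕ → (Fin N → ℝ) → ℝ)
    (hlsc : ∀ n, LowerSemicontinuousOn (useq n) O)
    (hmono : ∀ n, ∀ x ∈ O, useq n x ≤ useq (n + 1) x)
    (u : (Fin N → ℝ) → ℝ)
    (hu : ∀ x ∈ O, IsLUB (Set.range fun n => useq n x) (u x))
    (x : Fin N → ℝ) (hx : x ∈ O)
    (p : Fin N → ℝ) (Y : Matrix (Fin N) (Fin N) ℝ)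
    (hpY : InSubjet O u x p Y) (η : ℝ) (hη : 0 < η) :
    ∃ n₀ : ℕ, ∀ n ≥ n₀, ∃ z : (Fin N → ℝ) × ℝ, ‖z.1 - x‖ < η ∧ |z.2| < η ∧
      |useq n z.1 - u x| < η ∧ z.1 ∈ O ∧
      InSubjet O (useq n) z.1 (p + Y *ᵥ (z.1 - x) - (2 * z.2) • (z.1 - x))
        (Y - (2 * z.2) • (1 : Matrix (Fin N) (Fin N) ℝ)) := by
  obtain ⟨hY, hj⟩ := hpY
  obtain ⟨e, he, heη⟩ : ∃ e : ℝ, 0 < e ∧ e < η := exists_between hη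
  obtain ⟨δ₁, hδ₁, hj⟩ := hj (e / 2) (by positivity)
  obtain ⟨δ₂, hδ₂, hball⟩ := Metric.isOpen_iff.1 hO x hx
  obtain ⟨δ, hδ, hδ1, hδ2⟩ : ∃ δ : ℝ, 0 < δ ∧ δ ≤ δ₁ ∧ δ < δ₂ :=
    ⟨min δ₁ (δ₂ / 2), by positivity, min_le_left _ _,
      lt_of_le_of_lt (min_le_right _ _) (by linarith)⟩
  set B := Metric.closedBall x δ with hBdef
  have hBO : B ⊆ O := fun y hy => hball (lt_of_le_of_lt hy hδ2)
  have hBc : IsCompact B := isCompact_closedBall x δ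
  set φ : (Fin N → ℝ) → ℝ := fun y =>
    p ⬝ᵥ (y - x) + (1 / 2) * ((y - x) ⬝ᵥ Y *ᵥ (y - x)) - e * ((y - x) ⬝ᵥ (y - x)) with hφ
  have hφc : Continuous φ := by
    simp only [hφ]
    have hw : Continuous fun y : Fin N → ℝ => y - x := by fun_prop
    exact ((continuous_const.dotProduct hw).add (continuous_const.mul
      (hw.dotProduct (continuous_const.matrix_mulVec hw)))).sub
      (continuous_const.mul (hw.dotProduct hw))
  have hφx : φ x = 0 := by simp [hφ]
  obtain ⟨ρ, hρ, hφρ⟩ := Metric.continuousAt_iff.1 (hφc.continuousAt (x := x)) (η / 2) (by positivity)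
  set r := min ρ (min η δ) with hr
  have hr0 : 0 < r := by positivity
  set c := min (η / 2) (e / 2 * r ^ 2) with hc
  have hc0 : 0 < c := by positivity
  have hmon : ∀ y ∈ O, Monotone fun n => useq n y := fun y hy =>
    monotone_nat_of_le_succ fun n => hmono n y hy
  -- lower bound for the limit
  have hub : ∀ y ∈ B, u x ≤ u y - (φ y + e / 2 * ‖y - x‖ ^ 2) := by
    intro y hy
    have h1 := hj y (hBO hy) (le_trans (by simpa [hBdef, dist_eq_norm] using hy) hδ1)
    have h2 := mul_le_mul_of_nonneg_left (norm_sq_le_dot (y - x)) he.le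
    simp only [hφ]
    linarith
  have hgc : Continuous fun y => -(φ y + e / 2 * ‖y - x‖ ^ 2) := by fun_prop
  obtain ⟨n₀, hn₀⟩ := dini_lower hBc (fun n y => useq n y + -(φ y + e / 2 * ‖y - x‖ ^ 2))
    (fun n => ((hlsc n).mono hBO).add (hgc.lowerSemicontinuous.lowerSemicontinuousOn B))
    (fun y hy m n hmn => by
      have := hmon y (hBO hy) hmn
      simp only at this ⊢
      linarith) (u x - c) (fun y hy => by
      have h1 := hub y hy
      obtain ⟨_, ⟨n, rfl⟩, hn, -⟩ := (hu y (hBO hy)).exists_between (show u y - c < u y by linarith)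
      refine ⟨n, ?_⟩
      simp only at hn ⊢
      linarith)
  refine ⟨n₀, fun n hn => ?_⟩
  have hxB : x ∈ B := Metric.mem_closedBall_self hδ.le
  have hl : LowerSemicontinuousOn (fun y => useq n y + -φ y) B :=
    ((hlsc n).mono hBO).add (hφc.neg.lowerSemicontinuous.lowerSemicontinuousOn B)
  obtain ⟨z, hzB, hz⟩ := hl.exists_isMinOn ⟨x, hxB⟩ hBc
  have hz' : ∀ y ∈ B, useq n z + -φ z ≤ useq n y + -φ y := fun y hy => hz hy
  have h1 := hn₀ n hn z hzB
  have h2 := hz' x hxB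
  have h3 : useq n x ≤ u x := (hu x hx).1 ⟨n, rfl⟩
  rw [hφx] at h2
  have hzr : ‖z - x‖ < r := by
    have : e / 2 * ‖z - x‖ ^ 2 < e / 2 * r ^ 2 := by
      have := min_le_right (η / 2) (e / 2 * r ^ 2)
      linarith
    have := lt_of_mul_lt_mul_left this (by positivity)
    exact lt_of_pow_lt_pow_left₀ 2 hr0.le this
  have hzρ : ‖z - x‖ < ρ := lt_of_lt_of_le hzr (min_le_left _ _)
  have hzη : ‖z - x‖ < η := lt_of_lt_of_le hzr ((min_le_right _ _).trans (min_le_left _ _))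
  have hzδ : ‖z - x‖ < δ := lt_of_lt_of_le hzr ((min_le_right _ _).trans (min_le_right _ _))
  have hφz := hφρ (x := z) (by rwa [dist_eq_norm])
  rw [hφx, Real.dist_eq, sub_zero, abs_lt] at hφz
  have hcη : c ≤ η / 2 := min_le_left _ _
  have hpos : 0 ≤ e / 2 * ‖z - x‖ ^ 2 := by positivity
  refine ⟨(z, e), hzη, by rwa [abs_of_pos he], ?_, hBO hzB, ?_, ?_⟩
  · rw [abs_lt]
    constructor <;> simp only <;> linarith [hφz.1, hφz.2]
  · exact hY.sub (Matrix.isSymm_one.smul _)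
  · intro ε hε
    refine ⟨δ - ‖z - x‖, by linarith, fun y hyO hy => ?_⟩
    simp only at hy ⊢
    have hyB : y ∈ B := by
      rw [hBdef, Metric.mem_closedBall, dist_eq_norm]
      have := norm_add_le (y - z) (z - x)
      rw [sub_add_sub_cancel] at this
      linarith
    have h4 := hz' y hyB
    have h5 := quad_expand p (z - x) (y - z) Y hY e
    rw [show z - x + (y - z) = y - x by abel] at h5
    have h6 : 0 ≤ ε * ‖y - z‖ ^ 2 := by positivity
    simp only [hφ] at h4
    linarith

/-- Approximation of subjets along a nondecreasing sequence of LSC functions converging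
pointwise to `u`: every `(p,Y) ∈ J^{2,-} u (x)` is approximated by elements
`(p_n, Y_n) ∈ J^{2,-} u_n (x_n)` with `x_n → x`, `u_n(x_n) → u(x)`, `p_n → p`, `Y_n → Y`. -/
theorem subjet_approximation_increasing_convergence
    {N : ℕ} (O : Set (Fin N → ℝ)) (hO : IsOpen O)
    (useq : ℕ → (Fin N → ℝ) → ℝ)
    (hlsc : ∀ n, LowerSemicontinuousOn (useq n) O)
    (hmono : ∀ n, ∀ x ∈ O, useq n x ≤ useq (n + 1) x)
    (u : (Fin N → ℝ) → ℝ)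
    (hu : ∀ x ∈ O, IsLUB (Set.range fun n => useq n x) (u x))
    (x : Fin N → ℝ) (hx : x ∈ O)
    (p : Fin N → ℝ) (Y : Matrix (Fin N) (Fin N) ℝ)
    (hpY : InSubjet O u x p Y) :
    ∃ (n₀ : ℕ) (xs ps : ℕ → (Fin N → ℝ)) (Ys : ℕ → Matrix (Fin N) (Fin N) ℝ),
      (∀ n ≥ n₀, xs n ∈ O ∧ InSubjet O (useq n) (xs n) (ps n) (Ys n)) ∧
      Tendsto xs atTop (nhds x) ∧
      Tendsto (fun n => useq n (xs n)) atTop (nhds (u x)) ∧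
      Tendsto ps atTop (nhds p) ∧
      Tendsto Ys atTop (nhds Y) := by
  choose n0 hn0 using fun k : ℕ => subjet_step O hO useq hlsc hmono u hu x hx p Y hpY
    (1 / ((k : ℝ) + 1)) (by positivity)
  set k : ℕ → ℕ := fun n => Nat.findGreatest (fun k => n0 k ≤ n) n with hk
  have hk1 : ∀ n ≥ n0 0, n0 (k n) ≤ n := fun n hn =>
    Nat.findGreatest_spec (P := fun k => n0 k ≤ n) (Nat.zero_le n) hn
  have hk2 : Tendsto k atTop atTop := by
    refine tendsto_atTop.2 fun K => ?_
    filter_upwards [eventually_ge_atTop K, eventually_ge_atTop (n0 K)] with n h1 h2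
    exact Nat.le_findGreatest h1 h2
  have hex : ∀ n, ∃ z : (Fin N → ℝ) × ℝ, n ≥ n0 0 → ‖z.1 - x‖ < 1 / ((k n : ℝ) + 1) ∧
      |z.2| < 1 / ((k n : ℝ) + 1) ∧
      |useq n z.1 - u x| < 1 / ((k n : ℝ) + 1) ∧ z.1 ∈ O ∧
      InSubjet O (useq n) z.1 (p + Y *ᵥ (z.1 - x) - (2 * z.2) • (z.1 - x))
        (Y - (2 * z.2) • (1 : Matrix (Fin N) (Fin N) ℝ)) := by
    intro n
    by_cases h : n ≥ n0 0
    · obtain ⟨z, hz⟩ := hn0 (k n) n (hk1 n h)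
      exact ⟨z, fun _ => hz⟩
    · exact ⟨0, fun h' => absurd h' h⟩
  choose z hz using hex
  have hlim : Tendsto (fun n => 1 / ((k n : ℝ) + 1)) atTop (nhds 0) :=
    tendsto_one_div_add_atTop_nhds_zero_nat.comp hk2
  have hev : ∀ᶠ n in atTop, n ≥ n0 0 := eventually_ge_atTop _
  have t1 : Tendsto (fun n => (z n).1) atTop (nhds x) := by
    rw [tendsto_iff_norm_sub_tendsto_zero]
    exact squeeze_zero' (Eventually.of_forall fun n => norm_nonneg _)
      (hev.mono fun n hn => (hz n hn).1.le) hlim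
  have t2 : Tendsto (fun n => (z n).2) atTop (nhds 0) := by
    rw [tendsto_zero_iff_abs_tendsto_zero]
    exact squeeze_zero' (Eventually.of_forall fun n => abs_nonneg _)
      (hev.mono fun n hn => (hz n hn).2.1.le) hlim
  have t3 : Tendsto (fun n => useq n (z n).1) atTop (nhds (u x)) := by
    rw [tendsto_iff_norm_sub_tendsto_zero]
    exact squeeze_zero' (Eventually.of_forall fun n => norm_nonneg _)
      (hev.mono fun n hn => (hz n hn).2.2.1.le) hlim
  have t4 : Tendsto (fun n => 2 * (z n).2) atTop (nhds 0) := by simpa using t2.const_mul 2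
  have t5 : Tendsto (fun n => (z n).1 - x) atTop (nhds 0) := by simpa using t1.sub_const x
  refine ⟨n0 0, fun n => (z n).1, _, _, fun n hn => (hz n hn).2.2.2, t1, t3, ?_, ?_⟩
  · have hc : Continuous fun w : Fin N → ℝ => Y *ᵥ w :=
      continuous_const.matrix_mulVec continuous_id
    have := ((tendsto_const_nhds (x := p)).add ((hc.tendsto 0).comp t5)).sub (t4.smul t5)
    simpa using this
  · have := (tendsto_const_nhds (x := Y)).sub
      (t4.smul (tendsto_const_nhds (x := (1 : Matrix (Fin N) (Fin N) ℝ))))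
    simpa using this
end
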